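/- (Proposition 2, gauge expurgation.) Let (S, G) be a stabilizer subsystem code on N qubits, let g, ḡ ∈ C(S), and set G' = G + span{g, ḡ}. Then for every probability distribution p on V (every Pauli error channel), the optimal maximum-likelihood recovery probability satisfies P_R(S, G', p) ≥ P_R(S, G, p): expurgating logical operators into the gauge group never decreases the recovery probability. -/

import Mathlib

/-- The `F₂`-vector space of `N`-qubit Pauli operators modulo phase:
`v = (x, z)` represents `∏ᵢ Xᵢ^{xᵢ} Zᵢ^{zᵢ}`. -/
abbrev PauliV (N : ℕ) := (Fin N → ZMod 2) × (Fin N → ZMod 2)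

/-- The symplectic form `ω((x,z),(x',z')) = Σᵢ (xᵢ z'ᵢ + zᵢ x'ᵢ)`; it vanishes iff the
corresponding Pauli operators commute. -/
def omegaForm {N : ℕ} (v w : PauliV N) : ZMod 2 :=
  ∑ i, (v.1 i * w.2 i + v.2 i * w.1 i)

/-- The weight of a Pauli operator: the number of sites on which it acts nontrivially. -/
def pauliWeight {N : ℕ} (v : PauliV N) : ℕ :=
  (Finset.univ.filter fun i => v.1 i ≠ 0 ∨ v.2 i ≠ 0).card

/-- The commutant `C(S) = {v : ω(v, s) = 0 for all s ∈ S}` of a subspace `S`. -/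
def commutant {N : ℕ} (S : Submodule (ZMod 2) (PauliV N)) :
    Submodule (ZMod 2) (PauliV N) where
  carrier := {v | ∀ s ∈ S, omegaForm v s = 0}
  add_mem' := by
    intro a b ha hb s hs
    have h : omegaForm (a + b) s = omegaForm a s + omegaForm b s := by
      unfold omegaForm
      rw [← Finset.sum_add_distrib]
      refine Finset.sum_congr rfl fun i _ => ?_
      simp only [Prod.fst_add, Prod.snd_add, Pi.add_apply]
      ring
    simp only [Set.mem_setOf_eq] at *
    rw [h, ha s hs, hb s hs, add_zero]
  zero_mem' := by
    intro s hs
    simp [omegaForm]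
  smul_mem' := by
    intro c v hv s hs
    have h : omegaForm (c • v) s = c * omegaForm v s := by
      unfold omegaForm
      rw [Finset.mul_sum]
      refine Finset.sum_congr rfl fun i _ => ?_
      simp only [Prod.smul_fst, Prod.smul_snd, Pi.smul_apply, smul_eq_mul]
      ring
    simp only [Set.mem_setOf_eq] at *
    rw [h, hv s hs, mul_zero]

/-- The code distance of a stabilizer subsystem code `(S, G)`: the minimal weight of an
element of `C(S)` not in `G` (a bare logical operator). -/
noncomputable def codeDistance {N : ℕ} (S G : Submodule (ZMod 2) (PauliV N)) : ℕ :=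
  sInf {n | ∃ v, v ∈ commutant S ∧ v ∉ G ∧ pauliWeight v = n}

attribute [local instance] Classical.propDecidable

/-- The total probability `p(ℓ)` of the coset `ℓ = w + G` (a logical equivalence class). -/
noncomputable def cosetProb {N : ℕ} (G : Submodule (ZMod 2) (PauliV N))
    (p : PauliV N → ℝ) (w : PauliV N) : ℝ :=
  ∑ u : PauliV N, if u - w ∈ G then p u else 0

/-- The optimal (maximum-likelihood) recovery probability
`P_R(S, G, p) = Σ_c max_{ℓ ⊆ c} p(ℓ)`, where `c` ranges over the cosets of `C(S)` in `V`
(syndrome classes) and `ℓ` over the cosets of `G` contained in `c` (logical classes). -/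
noncomputable def recoveryProb {N : ℕ} (S G : Submodule (ZMod 2) (PauliV N))
    (p : PauliV N → ℝ) : ℝ :=
  ∑ᶠ c : PauliV N ⧸ commutant S,
    ⨆ w : {w : PauliV N // (Submodule.Quotient.mk w : PauliV N ⧸ commutant S) = c},
      cosetProb G p w.1

theorem cosetProb_mono {N : ℕ} {G G' : Submodule (ZMod 2) (PauliV N)} (h : G ≤ G')
    {p : PauliV N → ℝ} (hp : ∀ v, 0 ≤ p v) (w : PauliV N) :
    cosetProb G p w ≤ cosetProb G' p w := by
  unfold cosetProb
  gcongr with u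
  split_ifs with h₁ h₂
  · exact le_rfl
  · exact absurd (h h₁) h₂
  · exact hp u
  · exact le_rfl

theorem recoveryProb_mono {N : ℕ} (S : Submodule (ZMod 2) (PauliV N))
    {G G' : Submodule (ZMod 2) (PauliV N)} (h : G ≤ G')
    {p : PauliV N → ℝ} (hp : ∀ v, 0 ≤ p v) :
    recoveryProb S G p ≤ recoveryProb S G' p := by
  have := Fintype.ofFinite (PauliV N ⧸ commutant S)
  unfold recoveryProb
  rw [finsum_eq_sum_of_fintype, finsum_eq_sum_of_fintype]
  exact Finset.sum_le_sum fun _ _ =>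
    ciSup_mono (Set.finite_range _).bddAbove fun w => cosetProb_mono h hp w.1

/-- Proposition 2, gauge expurgation: if `(S, G)` is a stabilizer
subsystem code, `g, ḡ ∈ C(S)`, and `G' = G + span{g, ḡ}`, then for every probability
distribution `p` on `V` (every Pauli error channel) the optimal maximum-likelihood
recovery probability satisfies `P_R(S, G', p) ≥ P_R(S, G, p)`: expurgating logical
operators into the gauge group never decreases the recovery probability. -/
theorem gauge_expurgation_recovery (N : ℕ) (hN : 1 ≤ N)
    (S G : Submodule (ZMod 2) (PauliV N))
    (hSG : S ≤ G) (hGC : G ≤ commutant S)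
    (g gbar : PauliV N) (hg : g ∈ commutant S) (hgbar : gbar ∈ commutant S)
    (G' : Submodule (ZMod 2) (PauliV N))
    (hG' : G' = G ⊔ Submodule.span (ZMod 2) {g, gbar})
    (p : PauliV N → ℝ) (hp0 : ∀ v, 0 ≤ p v) (hp1 : ∑ v : PauliV N, p v = 1) :
    recoveryProb S G p ≤ recoveryProb S G' p :=
  recoveryProb_mono S (hG' ▸ le_sup_left) hp0
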